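/- For every integer k ≥ 10, if q ∈ (1,2) satisfies |q − q_k| ≤ q_k^{−2k−6}, then q ∈ B_3, i.e. there exists a point x ∈ I_q having exactly 3 base q expansions. -/

import Mathlib

open Set

/-- Projection map: the value of the (0-indexed) digit sequence `a` in base `q`,
`π_q(a) = Σ_{j=0}^∞ a_j q^{-(j+1)}`. -/
noncomputable def piQ (q : ℝ) (a : ℕ → ℝ) : ℝ := ∑' j : ℕ, a j / q ^ (j + 1)

/-- `a` is a sequence of digits in `{0,1}`. -/
def IsDigitSeq (a : ℕ → ℝ) : Prop := ∀ j, a j = 0 ∨ a j = 1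

/-- `a` is a sequence of digits in `{-1,0,1}`. -/
def IsExtDigitSeq (a : ℕ → ℝ) : Prop := ∀ j, a j = -1 ∨ a j = 0 ∨ a j = 1

/-- The set of base-`q` expansions of `x`. -/
def SigmaSet (q x : ℝ) : Set (ℕ → ℝ) := {a | IsDigitSeq a ∧ piQ q a = x}

/-- The interval `I_q = [0, 1/(q-1)]`. -/
def Iq (q : ℝ) : Set ℝ := Set.Icc 0 (1 / (q - 1))

/-- The switch region `J_q = [1/q, 1/(q(q-1))]`. -/
def Jq (q : ℝ) : Set ℝ := Set.Icc (1 / q) (1 / (q * (q - 1)))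

/-- The set of points of `I_q` having exactly `m` base-`q` expansions. -/
def UqM (q : ℝ) (m : ℕ∞) : Set ℝ := {x | x ∈ Iq q ∧ (SigmaSet q x).encard = m}

/-- The set of points of `I_q` having a unique base-`q` expansion. -/
def Uq (q : ℝ) : Set ℝ := UqM q 1

/-- `B_m`: the set of bases `q ∈ (1,2)` for which some point has exactly `m` expansions. -/
def Bset (m : ℕ∞) : Set ℝ := {q | q ∈ Set.Ioo (1 : ℝ) 2 ∧ (UqM q m).Nonempty}

/-- `x` is the `k`-Bonacci number: the root in `(1,2)` of `x^k = x^{k-1} + ⋯ + x + 1`. -/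
def IsBonacci (k : ℕ) (x : ℝ) : Prop :=
  x ∈ Set.Ioo (1 : ℝ) 2 ∧ x ^ k = ∑ i ∈ Finset.range k, x ^ i

/-- `a` contains no occurrence of the word `01^k` as a consecutive block. -/
def AvoidsWord01 (k : ℕ) (a : ℕ → ℝ) : Prop :=
  ∀ i, ¬(a i = 0 ∧ ∀ j, 1 ≤ j → j ≤ k → a (i + j) = 1)

/-- `a` contains no occurrence of the word `10^k` as a consecutive block. -/
def AvoidsWord10 (k : ℕ) (a : ℕ → ℝ) : Prop :=
  ∀ i, ¬(a i = 1 ∧ ∀ j, 1 ≤ j → j ≤ k → a (i + j) = 0)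

/-- `S_k`: the set of `{0,1}`-sequences avoiding the words `01^k` and `10^k`. -/
def Sset (k : ℕ) : Set (ℕ → ℝ) := {a | IsDigitSeq a ∧ AvoidsWord01 k a ∧ AvoidsWord10 k a}

/-- `g_{q,k} = f_1^{-(k-1)} ∘ f_0^{-1}`, where `f_0^{-1}(y) = y/q` and `f_1^{-1}(y) = (y+1)/q`. -/
noncomputable def gMap (q : ℝ) (k : ℕ) (x : ℝ) : ℝ := (fun y => (y + 1) / q)^[k - 1] (x / q)

/-- The maps `f_0(x) = qx` (for `b = false`) and `f_1(x) = qx - 1` (for `b = true`). -/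
noncomputable def fDigit (q : ℝ) (b : Bool) (x : ℝ) : ℝ := if b then q * x - 1 else q * x

/-- `(a, b)` is a bounded gap of `C`: a bounded connected component of `ℝ \ C`. -/
def IsGap (C : Set ℝ) (a b : ℝ) : Prop :=
  a < b ∧ a ∈ C ∧ b ∈ C ∧ Set.Ioo a b ∩ C = ∅

/-- The left endpoint of the bridge of `C` lying immediately to the left of the gap `(a, b)`:
the right endpoint of the nearest gap to the left having diameter at least `b - a`
(or `min C` if there is no such gap). -/
noncomputable def leftBridgeStart (C : Set ℝ) (a b : ℝ) : ℝ :=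
  sSup ({sInf C} ∪ {d | ∃ c, IsGap C c d ∧ d ≤ a ∧ b - a ≤ d - c})

/-- The right endpoint of the bridge of `C` lying immediately to the right of the gap `(a, b)`. -/
noncomputable def rightBridgeEnd (C : Set ℝ) (a b : ℝ) : ℝ :=
  sInf ({sSup C} ∪ {c | ∃ d, IsGap C c d ∧ b ≤ c ∧ b - a ≤ d - c})

/-- The (Newhouse) thickness of a compact set `C ⊆ ℝ`: the infimum over all bounded gaps `G`
of the ratio of the length of the bridge on either side of `G` to the length of `G`
(`∞` if `C` has no bounded gap). -/
noncomputable def thickness (C : Set ℝ) : ENNReal :=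
  ⨅ p : {p : ℝ × ℝ // IsGap C p.1 p.2},
    ENNReal.ofReal
      (min ((p.1.1 - leftBridgeStart C p.1.1 p.1.2) / (p.1.2 - p.1.1))
        ((rightBridgeEnd C p.1.1 p.1.2 - p.1.2) / (p.1.2 - p.1.1)))

/-- `B` is contained in a gap of `A`, i.e. in a connected component of `ℝ \ A`. -/
def ContainedInGap (B A : Set ℝ) : Prop :=
  ∃ x ∈ Aᶜ, B ⊆ connectedComponentIn Aᶜ x

/-- Two sets are interleaved if neither is contained in a gap of the other. -/
def Interleaved (A B : Set ℝ) : Prop :=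
  ¬ContainedInGap B A ∧ ¬ContainedInGap A B

/-- `A` and `B` are `ε`-strongly interleaved: any compact sets within Hausdorff distance `ε`
of `A` and `B` respectively are interleaved. -/
def StronglyInterleaved (ε : ℝ) (A B : Set ℝ) : Prop :=
  ∀ A' B' : Set ℝ, IsCompact A' → IsCompact B' →
    EMetric.hausdorffEdist A A' ≤ ENNReal.ofReal ε →
    EMetric.hausdorffEdist B B' ≤ ENNReal.ofReal ε → Interleaved A' B'

/-- The sequence `0^{k-3}(01^{k-1})^∞` (0-indexed). -/
noncomputable def seqG (k : ℕ) : ℕ → ℝ := fun j =>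
  if j < k - 3 then 0 else if (j - (k - 3)) % k = 0 then 0 else 1

/-- The sequence `1^{k-3}(10^{k-1})^∞` (0-indexed). -/
noncomputable def seqH (k : ℕ) : ℕ → ℝ := fun j =>
  if j < k - 3 then 1 else if (j - (k - 3)) % k = 0 then 1 else 0

/-- The sequence `(1^{k-1}0)^∞` (0-indexed). -/
noncomputable def seqP (k : ℕ) : ℕ → ℝ := fun j => if j % k = k - 1 then 0 else 1


/-! ### Sequences of binary digits and their values -/

/-- The sequence `s` with the digit `p` put in front. -/
def consSeq (p : ℝ) (s : ℕ → ℝ) : ℕ → ℝ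
  | 0 => p
  | n + 1 => s n

/-- The sequence `s` with its first digit removed. -/
def tailSeq (s : ℕ → ℝ) : ℕ → ℝ := fun n => s (n + 1)

lemma consSeq_tailSeq (s : ℕ → ℝ) : consSeq (s 0) (tailSeq s) = s := by
  funext n
  cases n <;> rfl

lemma tailSeq_consSeq (p : ℝ) (s : ℕ → ℝ) : tailSeq (consSeq p s) = s := rfl

lemma IsDigitSeq.consSeq {p : ℝ} {s : ℕ → ℝ} (hp : p = 0 ∨ p = 1) (hs : IsDigitSeq s) :
    IsDigitSeq (consSeq p s) := by
  intro n
  cases n with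
  | zero => exact hp
  | succ n => exact hs n

lemma IsDigitSeq.tailSeq {s : ℕ → ℝ} (hs : IsDigitSeq s) : IsDigitSeq (tailSeq s) :=
  fun n => hs (n + 1)

lemma IsDigitSeq.iterate_consSeq {p : ℝ} {s : ℕ → ℝ} (hp : p = 0 ∨ p = 1) (hs : IsDigitSeq s)
    (n : ℕ) : IsDigitSeq ((_root_.consSeq p)^[n] s) := by
  induction n with
  | zero => exact hs
  | succ n ih =>
    rw [Function.iterate_succ_apply']
    exact ih.consSeq hp

lemma hasSum_one_div_pow_succ {q : ℝ} (hq : 1 < q) :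
    HasSum (fun j : ℕ => 1 / q ^ (j + 1)) (1 / (q - 1)) := by
  have h := (hasSum_geometric_of_lt_one (inv_nonneg.2 (by linarith : (0 : ℝ) ≤ q))
    (inv_lt_one_of_one_lt₀ hq)).mul_left q⁻¹
  have hq0 : q ≠ 0 := by linarith
  have hq1 : q - 1 ≠ 0 := by linarith
  have e1 : (fun j : ℕ => 1 / q ^ (j + 1)) = fun j : ℕ => q⁻¹ * q⁻¹ ^ j := by
    funext j
    rw [← pow_succ', inv_pow, one_div]
  have e2 : 1 / (q - 1) = q⁻¹ * (1 - q⁻¹)⁻¹ := by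
    rw [← mul_inv, mul_sub, mul_one, mul_inv_cancel₀ hq0, one_div]
  rwa [e1, e2]

lemma IsDigitSeq.nonneg {s : ℕ → ℝ} (hs : IsDigitSeq s) (n : ℕ) : 0 ≤ s n := by
  rcases hs n with h | h <;> norm_num [h]

lemma IsDigitSeq.le_one {s : ℕ → ℝ} (hs : IsDigitSeq s) (n : ℕ) : s n ≤ 1 := by
  rcases hs n with h | h <;> norm_num [h]

lemma IsDigitSeq.one_sub {s : ℕ → ℝ} (hs : IsDigitSeq s) : IsDigitSeq (fun n => 1 - s n) := by
  intro n
  rcases hs n with h | h <;> simp [h]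

lemma IsDigitSeq.summable {q : ℝ} (hq : 1 < q) {s : ℕ → ℝ} (hs : IsDigitSeq s) :
    Summable (fun j : ℕ => s j / q ^ (j + 1)) := by
  have hq0 : 0 < q := by linarith
  refine Summable.of_nonneg_of_le (fun j => ?_) (fun j => ?_) (hasSum_one_div_pow_succ hq).summable
  · exact div_nonneg (hs.nonneg j) (by positivity)
  · exact div_le_div_of_nonneg_right (hs.le_one j) (by positivity)

lemma piQ_consSeq {q : ℝ} (hq : 1 < q) (p : ℝ) {s : ℕ → ℝ} (hs : IsDigitSeq s) :
    piQ q (consSeq p s) = (p + piQ q s) / q := by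
  have hq0 : q ≠ 0 := by linarith
  have h1 : (fun j : ℕ => consSeq p s (j + 1) / q ^ (j + 1 + 1))
      = fun j : ℕ => s j / q ^ (j + 1) / q := by
    funext j
    rw [pow_succ q (j + 1), div_div]
    rfl
  have h2 : Summable (fun j : ℕ => consSeq p s j / q ^ (j + 1)) := by
    rw [← summable_nat_add_iff 1, h1]
    exact (hs.summable hq).div_const q
  unfold piQ
  rw [h2.tsum_eq_zero_add, h1, tsum_div_const]
  simp only [zero_add, pow_one, add_div]
  rfl

lemma piQ_eq_head_add_tail {q : ℝ} (hq : 1 < q) {s : ℕ → ℝ} (hs : IsDigitSeq s) :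
    piQ q s = (s 0 + piQ q (tailSeq s)) / q := by
  rw [← piQ_consSeq hq _ hs.tailSeq, consSeq_tailSeq]

lemma piQ_iterate_consSeq {q : ℝ} (hq : 1 < q) {p : ℝ} (hp : p = 0 ∨ p = 1) {s : ℕ → ℝ}
    (hs : IsDigitSeq s) (n : ℕ) :
    q ^ n * piQ q ((consSeq p)^[n] s) = p * (q ^ n - 1) / (q - 1) + piQ q s := by
  have hq0 : q ≠ 0 := by linarith
  have hq1 : q - 1 ≠ 0 := by linarith
  induction n with
  | zero => simp
  | succ n ih =>
    rw [Function.iterate_succ_apply', piQ_consSeq hq p (hs.iterate_consSeq hp n)]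
    have : q ^ (n + 1) * ((p + piQ q ((consSeq p)^[n] s)) / q)
        = q ^ n * p + q ^ n * piQ q ((consSeq p)^[n] s) := by
      field_simp
      ring
    rw [this, ih]
    field_simp
    ring

lemma one_div_pow_le_piQ {q : ℝ} (hq : 1 < q) {s : ℕ → ℝ} (hs : IsDigitSeq s) {m : ℕ}
    (hm : s m = 1) : 1 / q ^ (m + 1) ≤ piQ q s := by
  have hq0 : 0 < q := by linarith
  have := (hs.summable hq).le_tsum m
    (fun j _ => div_nonneg (hs.nonneg j) (by positivity))
  rwa [hm] at this

lemma piQ_nonneg {q : ℝ} (hq : 1 < q) {s : ℕ → ℝ} (hs : IsDigitSeq s) : 0 ≤ piQ q s := by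
  have hq0 : 0 < q := by linarith
  exact tsum_nonneg (fun j => div_nonneg (hs.nonneg j) (by positivity))

lemma piQ_one_sub {q : ℝ} (hq : 1 < q) {s : ℕ → ℝ} (hs : IsDigitSeq s) :
    piQ q (fun n => 1 - s n) = 1 / (q - 1) - piQ q s := by
  have h := (hasSum_one_div_pow_succ hq).sub (hs.summable hq).hasSum
  unfold piQ
  rw [← h.tsum_eq]
  congr 1
  funext j
  rw [sub_div]

lemma piQ_le {q : ℝ} (hq : 1 < q) {s : ℕ → ℝ} (hs : IsDigitSeq s) : piQ q s ≤ 1 / (q - 1) := by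
  have := piQ_nonneg hq hs.one_sub
  rw [piQ_one_sub hq hs] at this
  linarith

lemma piQ_le_sub_one_div_pow {q : ℝ} (hq : 1 < q) {s : ℕ → ℝ} (hs : IsDigitSeq s) {m : ℕ}
    (hm : s m = 0) : piQ q s ≤ 1 / (q - 1) - 1 / q ^ (m + 1) := by
  have := one_div_pow_le_piQ hq hs.one_sub (m := m) (by simp [hm])
  rw [piQ_one_sub hq hs] at this
  linarith

/-! ### Forced digits and unique expansions -/

lemma head_eq_zero_of_piQ_lt {q : ℝ} (hq : 1 < q) {s : ℕ → ℝ} (hs : IsDigitSeq s)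
    (h : q * piQ q s < 1) : s 0 = 0 := by
  rcases hs 0 with h0 | h0
  · exact h0
  · have h1 := piQ_eq_head_add_tail hq hs
    have h2 := piQ_nonneg hq hs.tailSeq
    rw [eq_div_iff (by linarith), h0] at h1
    linarith

lemma head_eq_one_of_lt_piQ {q : ℝ} (hq : 1 < q) {s : ℕ → ℝ} (hs : IsDigitSeq s)
    (h : 1 / (q - 1) < q * piQ q s) : s 0 = 1 := by
  rcases hs 0 with h0 | h0
  · have h1 := piQ_eq_head_add_tail hq hs
    have h2 := piQ_le hq hs.tailSeq
    rw [eq_div_iff (by linarith), h0] at h1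
    linarith
  · exact h0

/-- Every digit of `s` is repeated within the next `7` places. -/
def RepeatsSoon (s : ℕ → ℝ) : Prop := ∀ n, ∃ m < 7, s (n + 1 + m) = s n

lemma RepeatsSoon.tailSeq {s : ℕ → ℝ} (hs : RepeatsSoon s) : RepeatsSoon (tailSeq s) := by
  intro n
  obtain ⟨m, hm, h⟩ := hs (n + 1)
  refine ⟨m, hm, ?_⟩
  rw [← show s (n + 1) = _root_.tailSeq s n from rfl, ← h]
  unfold _root_.tailSeq
  congr 1
  ring

lemma one_div_pow_le_one_div_pow_succ {q : ℝ} (hq : 1 < q) {m : ℕ} (hm : m < 7) :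
    1 / q ^ 7 ≤ 1 / q ^ (m + 1) := by
  have hq0 : 0 < q := by linarith
  exact one_div_le_one_div_of_le (by positivity) (pow_le_pow_right₀ hq.le hm)

lemma RepeatsSoon.head_eq {q : ℝ} (hq : 1 < q) (hδ : 1 / (q - 1) - 1 < 1 / q ^ 7) {a s : ℕ → ℝ}
    (ha : IsDigitSeq a) (hr : RepeatsSoon a) (hs : IsDigitSeq s) (h : piQ q s = piQ q a) :
    s 0 = a 0 := by
  obtain ⟨m, hm, hm'⟩ := hr 0
  have h1 := piQ_eq_head_add_tail hq ha
  rw [eq_div_iff (by linarith)] at h1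
  have h7 := one_div_pow_le_one_div_pow_succ hq hm
  have hmt : _root_.tailSeq a m = a 0 := by
    rw [← hm']
    unfold _root_.tailSeq
    congr 1
    ring
  rcases ha 0 with h0 | h0
  · rw [h0]
    apply head_eq_zero_of_piQ_lt hq hs
    have := piQ_le_sub_one_div_pow hq ha.tailSeq (hmt.trans h0)
    rw [h, mul_comm, h1, h0]
    linarith
  · rw [h0]
    apply head_eq_one_of_lt_piQ hq hs
    have := one_div_pow_le_piQ hq ha.tailSeq (hmt.trans h0)
    rw [h, mul_comm, h1, h0]
    linarith

lemma piQ_tailSeq_eq {q : ℝ} (hq : 1 < q) {a s : ℕ → ℝ} (ha : IsDigitSeq a) (hs : IsDigitSeq s)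
    (h : piQ q s = piQ q a) (h0 : s 0 = a 0) : piQ q (tailSeq s) = piQ q (tailSeq a) := by
  have h1 := piQ_eq_head_add_tail hq ha
  have h2 := piQ_eq_head_add_tail hq hs
  rw [eq_div_iff (by linarith)] at h1 h2
  rw [h, h0] at h2
  linarith

lemma RepeatsSoon.eq_of_piQ_eq {q : ℝ} (hq : 1 < q) (hδ : 1 / (q - 1) - 1 < 1 / q ^ 7)
    {a s : ℕ → ℝ} (ha : IsDigitSeq a) (hr : RepeatsSoon a) (hs : IsDigitSeq s)
    (h : piQ q s = piQ q a) : s = a := by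
  funext n
  induction n generalizing a s with
  | zero => exact hr.head_eq hq hδ ha hs h
  | succ n ih =>
    exact ih ha.tailSeq hr.tailSeq hs.tailSeq
      (piQ_tailSeq_eq hq ha hs h (hr.head_eq hq hδ ha hs h))

/-- An expansion of a small number starts with zeros. -/
lemma exists_eq_iterate_consSeq_zero {q : ℝ} (hq : 1 < q) {z s : ℕ → ℝ} (hz : IsDigitSeq z)
    (hz1 : piQ q z < 1) (n : ℕ) (hs : IsDigitSeq s)
    (h : piQ q s = piQ q ((consSeq 0)^[n] z)) :
    ∃ s', IsDigitSeq s' ∧ piQ q s' = piQ q z ∧ s = (consSeq 0)^[n] s' := by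
  induction n generalizing s with
  | zero => exact ⟨s, hs, h, rfl⟩
  | succ n ih =>
    have hd := hz.iterate_consSeq (p := 0) (Or.inl rfl)
    have hlt : piQ q ((consSeq 0)^[n] z) < 1 := by
      have h1 := piQ_iterate_consSeq hq (p := 0) (Or.inl rfl) hz n
      rw [zero_mul, zero_div, zero_add] at h1
      have h2 : 1 ≤ q ^ n := one_le_pow₀ hq.le
      have h3 := piQ_nonneg hq (hd n)
      nlinarith
    rw [Function.iterate_succ_apply'] at h
    have hval : q * piQ q s = piQ q ((consSeq 0)^[n] z) := by
      rw [h, piQ_consSeq hq 0 (hd n), zero_add, mul_div_cancel₀ _ (by linarith)]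
    have h0 : s 0 = 0 := head_eq_zero_of_piQ_lt hq hs (by rw [hval]; exact hlt)
    have ht : piQ q (tailSeq s) = piQ q ((consSeq 0)^[n] z) := by
      have := piQ_tailSeq_eq hq ((hd n).consSeq (Or.inl rfl)) hs h h0
      rwa [tailSeq_consSeq] at this
    obtain ⟨s', h1, h2, h3⟩ := ih hs.tailSeq ht
    refine ⟨s', h1, h2, ?_⟩
    rw [Function.iterate_succ_apply', ← h3, ← h0, consSeq_tailSeq]

/-! ### Sequences whose blocks of length four are not constant -/

/-- Each block of `s` at the places `4j, …, 4j + 3` contains both digits. -/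
def HasMixedBlocks (s : ℕ → ℝ) : Prop :=
  ∀ p : ℝ, p = 0 ∨ p = 1 → ∀ j, ∃ r < 4, s (4 * j + r) = p

lemma HasMixedBlocks.repeatsSoon {s : ℕ → ℝ} (hd : IsDigitSeq s) (hs : HasMixedBlocks s) :
    RepeatsSoon s := by
  intro n
  obtain ⟨r, hr, h⟩ := hs (s n) (hd n) (n / 4 + 1)
  refine ⟨4 * (n / 4 + 1) + r - (n + 1), by omega, ?_⟩
  rw [← h]
  congr 1
  omega

lemma HasMixedBlocks.repeatsSoon_iterate_consSeq {s : ℕ → ℝ} (hd : IsDigitSeq s)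
    (hs : HasMixedBlocks s) {p : ℝ} (hp : p = 0 ∨ p = 1) (k : ℕ) :
    RepeatsSoon ((consSeq p)^[k] s) ∧ ∃ r < 4, (consSeq p)^[k] s r = p := by
  induction k with
  | zero =>
    obtain ⟨r, hr, h⟩ := hs p hp 0
    exact ⟨hs.repeatsSoon hd, r, hr, by simpa using h⟩
  | succ k ih =>
    rw [Function.iterate_succ_apply']
    obtain ⟨h1, r, hr, h2⟩ := ih
    refine ⟨fun n => ?_, 0, by norm_num, rfl⟩
    cases n with
    | zero =>
      refine ⟨r, by omega, ?_⟩
      rw [show 0 + 1 + r = r + 1 by ring]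
      exact h2
    | succ n =>
      obtain ⟨m, hm, h⟩ := h1 n
      refine ⟨m, hm, ?_⟩
      rw [show n + 1 + 1 + m = (n + 1 + m) + 1 by ring]
      exact h

/-- The `r`-th of the four binary digits of `n`, the most significant one being the `0`-th. -/
def nibbleDigit (n r : ℕ) : ℝ := if n.testBit (3 - r) then 1 else 0

/-- The value in base `q` of the four binary digits of `n`. -/
def nibbleValue (q : ℝ) (n : ℕ) : ℝ :=
  nibbleDigit n 0 * q ^ 3 + nibbleDigit n 1 * q ^ 2 + nibbleDigit n 2 * q + nibbleDigit n 3

lemma nibbleDigit_eq (n r : ℕ) : nibbleDigit n r = 0 ∨ nibbleDigit n r = 1 := by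
  unfold nibbleDigit
  split_ifs <;> simp

lemma nibbleValue_mem {q : ℝ} (h1 : 1.9989 ≤ q) (h2 : q < 2) {n : ℕ} (hn : n ≤ 14) :
    nibbleValue q n ∈ Set.Icc ((n : ℝ) - 0.02) n := by
  have e1 : 3.9956 ≤ q ^ 2 := by nlinarith
  have e2 : q ^ 2 ≤ 4 := by nlinarith
  have e3 : 7.9868 ≤ q ^ 3 := by nlinarith
  have e4 : q ^ 3 ≤ 8 := by nlinarith
  interval_cases n <;> norm_num [nibbleValue, nibbleDigit, Nat.testBit, Nat.shiftRight_eq_div_pow] <;>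
    constructor <;> linarith

lemma exists_nibbleDigit_eq {n : ℕ} (hn : n ∈ Finset.Icc 1 14) {p : ℝ} (hp : p = 0 ∨ p = 1) :
    ∃ r < 4, nibbleDigit n r = p := by
  have key : ∀ n ∈ Finset.Icc 1 14, ∀ b : Bool, ∃ r < 4, Nat.testBit n (3 - r) = b := by decide
  rcases hp with rfl | rfl
  · obtain ⟨r, hr, h⟩ := key n hn false
    exact ⟨r, hr, by simp [nibbleDigit, h]⟩
  · obtain ⟨r, hr, h⟩ := key n hn true
    exact ⟨r, hr, by simp [nibbleDigit, h]⟩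

/-- The sequence of binary digits obtained by concatenating the four digits of each `N j`. -/
def nibbleSeq (N : ℕ → ℕ) : ℕ → ℝ := fun i => nibbleDigit (N (i / 4)) (i % 4)

lemma isDigitSeq_nibbleSeq (N : ℕ → ℕ) : IsDigitSeq (nibbleSeq N) := fun _ => nibbleDigit_eq _ _

lemma nibbleSeq_block (N : ℕ → ℕ) (j : ℕ) {r : ℕ} (hr : r < 4) :
    nibbleSeq N (4 * j + r) = nibbleDigit (N j) r := by
  unfold nibbleSeq
  congr 2 <;> omega

lemma hasMixedBlocks_nibbleSeq {N : ℕ → ℕ} (hN : ∀ j, N j ∈ Finset.Icc 1 14) :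
    HasMixedBlocks (nibbleSeq N) := by
  intro p hp j
  obtain ⟨r, hr, h⟩ := exists_nibbleDigit_eq (hN j) hp
  exact ⟨r, hr, by rw [nibbleSeq_block N j hr, h]⟩

lemma sum_range_nibbleSeq {q : ℝ} (hq : q ≠ 0) (N : ℕ → ℕ) (n : ℕ) :
    ∑ i ∈ Finset.range (4 * n), nibbleSeq N i / q ^ (i + 1)
      = ∑ j ∈ Finset.range n, nibbleValue q (N j) / (q ^ 4) ^ (j + 1) := by
  induction n with
  | zero => simp
  | succ n ih =>
    rw [show 4 * (n + 1) = 4 * n + 1 + 1 + 1 + 1 by ring, Finset.sum_range_succ,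
      Finset.sum_range_succ, Finset.sum_range_succ, Finset.sum_range_succ, ih,
      Finset.sum_range_succ]
    have h0 := nibbleSeq_block N n (show 0 < 4 by norm_num)
    have h1 := nibbleSeq_block N n (show 1 < 4 by norm_num)
    have h2 := nibbleSeq_block N n (show 2 < 4 by norm_num)
    have h3 := nibbleSeq_block N n (show 3 < 4 by norm_num)
    rw [add_zero] at h0
    rw [h0, h1, show 4 * n + 1 + 1 = 4 * n + 2 by ring, show 4 * n + 2 + 1 = 4 * n + 3 by ring,
      h2, h3]
    generalize ∑ j ∈ Finset.range n, nibbleValue q (N j) / (q ^ 4) ^ (j + 1) = S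
    unfold nibbleValue
    rw [← pow_mul, show 4 * (n + 1) = 4 * n + 4 by ring]
    simp only [pow_add]
    field_simp
    ring

lemma tendsto_sum_nibbleValue {q : ℝ} (hq : 1 < q) (N : ℕ → ℕ) :
    Filter.Tendsto
      (fun n => ∑ j ∈ Finset.range n, nibbleValue q (N j) / (q ^ 4) ^ (j + 1))
      Filter.atTop (nhds (piQ q (nibbleSeq N))) := by
  have h := ((isDigitSeq_nibbleSeq N).summable hq).hasSum.tendsto_sum_nat
  have h4 : Filter.Tendsto (fun n : ℕ => 4 * n) Filter.atTop Filter.atTop :=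
    Filter.tendsto_id.const_mul_atTop' (by norm_num)
  refine (h.comp h4).congr (fun n => ?_)
  exact sum_range_nibbleSeq (by linarith) N n

/-! ### Three mixed sequences with prescribed differences -/

/-- The three numbers `0`, `p.1`, `p.2` are at mutual distance at most `7/10`. -/
def InHexagon (p : ℝ × ℝ) : Prop := |p.1| ≤ 0.7 ∧ |p.2| ≤ 0.7 ∧ |p.1 - p.2| ≤ 0.7

/-- Modulo the integers, any three reals lie in an arc of length `2/3`. -/
lemma exists_int_spread_le (x y : ℝ) :
    ∃ m n : ℤ, |x - m| ≤ 2 / 3 ∧ |y - n| ≤ 2 / 3 ∧ |(x - m) - (y - n)| ≤ 2 / 3 := by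
  wlog h : Int.fract x ≤ Int.fract y generalizing x y
  · obtain ⟨m, n, h1, h2, h3⟩ := this y x (le_of_not_ge h)
    exact ⟨n, m, h2, h1, by rwa [abs_sub_comm]⟩
  have hx := Int.self_sub_floor x
  have hy := Int.self_sub_floor y
  have hx0 := Int.fract_nonneg x
  have hy1 := Int.fract_lt_one y
  by_cases h1 : Int.fract y ≤ 2 / 3
  · refine ⟨⌊x⌋, ⌊y⌋, ?_, ?_, ?_⟩ <;> rw [abs_le] <;> constructor <;> linarith
  · by_cases h2 : 1 / 3 ≤ Int.fract x
    · refine ⟨⌊x⌋ + 1, ⌊y⌋ + 1, ?_, ?_, ?_⟩ <;> push_cast <;> rw [abs_le] <;>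
        constructor <;> linarith
    · refine ⟨⌊x⌋, ⌊y⌋ + 1, ?_, ?_, ?_⟩ <;> push_cast <;> rw [abs_le] <;>
        constructor <;> linarith

/-- Three integers within distance `13` of each other can be moved into `{1, …, 14}`. -/
lemma exists_nat_translate (m n : ℤ) (hm : |m| ≤ 13) (hn : |n| ≤ 13) (hmn : |m - n| ≤ 13) :
    ∃ N : Fin 3 → ℕ, (∀ i, N i ∈ Finset.Icc 1 14) ∧ (N 1 : ℤ) - N 0 = m ∧ (N 2 : ℤ) - N 0 = n := by
  rw [abs_le] at hm hn hmn
  refine ⟨![(1 - min 0 (min m n)).toNat, (1 - min 0 (min m n) + m).toNat,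
    (1 - min 0 (min m n) + n).toNat], fun i => ?_, ?_, ?_⟩
  · fin_cases i <;> simp <;> omega
  · simp
    omega
  · simp
    omega

lemma InHexagon.exists_step {q : ℝ} (h1 : 1.9989 ≤ q) (h2 : q < 2) {p : ℝ × ℝ}
    (hp : InHexagon p) :
    ∃ N : Fin 3 → ℕ, (∀ i, N i ∈ Finset.Icc 1 14) ∧
      InHexagon (q ^ 4 * p.1 - (nibbleValue q (N 1) - nibbleValue q (N 0)),
        q ^ 4 * p.2 - (nibbleValue q (N 2) - nibbleValue q (N 0))) := by
  obtain ⟨hx, hy, hxy⟩ := hp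
  obtain ⟨m, n, hm, hn, hmn⟩ := exists_int_spread_le (q ^ 4 * p.1) (q ^ 4 * p.2)
  have hQ0 : 0 ≤ q ^ 4 := by positivity
  have hQ : q ^ 4 ≤ 16 := by
    calc q ^ 4 ≤ 2 ^ 4 := pow_le_pow_left₀ (by linarith) h2.le 4
      _ = 16 := by norm_num
  have bound : ∀ u : ℝ, |u| ≤ 0.7 → |q ^ 4 * u| ≤ 11.2 := by
    intro u hu
    rw [abs_mul, abs_of_nonneg hQ0]
    nlinarith [abs_nonneg u]
  have bx := bound _ hx
  have bY := bound _ hy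
  have bxy := bound _ hxy
  rw [mul_sub] at bxy
  rw [abs_le] at bx bY bxy hm hn hmn
  have small : ∀ j : ℤ, |(j : ℝ)| < 13 → |j| ≤ 13 := by
    intro j hj
    have : |j| < 13 := by exact_mod_cast hj
    exact this.le
  obtain ⟨N, hN, e1, e2⟩ := exists_nat_translate m n
    (small m (by rw [abs_lt]; constructor <;> linarith))
    (small n (by rw [abs_lt]; constructor <;> linarith))
    (small (m - n) (by push_cast; rw [abs_lt]; constructor <;> linarith))
  refine ⟨N, hN, ?_⟩
  have hv : ∀ i, nibbleValue q (N i) ∈ Set.Icc ((N i : ℝ) - 0.02) (N i) :=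
    fun i => nibbleValue_mem h1 h2 (Finset.mem_Icc.1 (hN i)).2
  obtain ⟨a0, b0⟩ := hv 0
  obtain ⟨a1, b1⟩ := hv 1
  obtain ⟨a2, b2⟩ := hv 2
  have e1' : (N 1 : ℝ) - N 0 = m := by exact_mod_cast e1
  have e2' : (N 2 : ℝ) - N 0 = n := by exact_mod_cast e2
  refine ⟨?_, ?_, ?_⟩ <;> rw [abs_le] <;> constructor <;> norm_num <;> linarith

/-- The value of a digit sequence that follows a bounded orbit of an expanding map. -/
lemma piQ_sub_piQ_of_orbit {q : ℝ} (hq : 1 < q) {M N : ℕ → ℕ} {x : ℕ → ℝ}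
    (hb : ∀ n, |x n| ≤ 0.7)
    (hx : ∀ n, x (n + 1) = q ^ 4 * x n - (nibbleValue q (N n) - nibbleValue q (M n))) :
    piQ q (nibbleSeq N) = piQ q (nibbleSeq M) + x 0 := by
  have hq0 : 0 < q := by linarith
  have hQ : 1 < q ^ 4 := one_lt_pow₀ hq (by norm_num)
  have hsum : ∀ n, ∑ j ∈ Finset.range n, nibbleValue q (N j) / (q ^ 4) ^ (j + 1)
      - ∑ j ∈ Finset.range n, nibbleValue q (M j) / (q ^ 4) ^ (j + 1)
      = x 0 - x n * ((q ^ 4) ^ n)⁻¹ := by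
    intro n
    induction n with
    | zero => simp
    | succ n ih =>
      rw [Finset.sum_range_succ, Finset.sum_range_succ, add_sub_add_comm, ih, hx n, pow_succ]
      field_simp
      ring
  have hlim : Filter.Tendsto (fun n => x 0 - x n * ((q ^ 4) ^ n)⁻¹) Filter.atTop (nhds (x 0)) := by
    have h0 : Filter.Tendsto (fun n : ℕ => x n * ((q ^ 4) ^ n)⁻¹) Filter.atTop (nhds 0) := by
      have hinv : Filter.Tendsto (fun n : ℕ => 0.7 * ((q ^ 4) ^ n)⁻¹) Filter.atTop (nhds 0) := by
        simpa using (tendsto_inv_atTop_zero.comp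
          (tendsto_pow_atTop_atTop_of_one_lt hQ)).const_mul (0.7 : ℝ)
      refine squeeze_zero_norm (fun n => ?_) hinv
      rw [norm_mul, Real.norm_eq_abs, Real.norm_of_nonneg (by positivity)]
      exact mul_le_mul_of_nonneg_right (hb n) (by positivity)
    simpa using tendsto_const_nhds.sub h0
  have h := (tendsto_sum_nibbleValue hq N).sub (tendsto_sum_nibbleValue hq M)
  have := tendsto_nhds_unique (h.congr hsum) hlim
  linarith

lemma exists_three_mixed {q : ℝ} (h1 : 1.9989 ≤ q) (h2 : q < 2) {p : ℝ × ℝ}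
    (hp : InHexagon p) :
    ∃ a b c : ℕ → ℝ, (IsDigitSeq a ∧ HasMixedBlocks a) ∧ (IsDigitSeq b ∧ HasMixedBlocks b) ∧
      (IsDigitSeq c ∧ HasMixedBlocks c) ∧
      piQ q b = piQ q a + p.1 ∧ piQ q c = piQ q a + p.2 := by
  choose N hN hstep using fun v : {v : ℝ × ℝ // InHexagon v} => v.2.exists_step h1 h2
  let orbit : ℕ → {v : ℝ × ℝ // InHexagon v} := fun n =>
    (fun v => (⟨_, hstep v⟩ : {v : ℝ × ℝ // InHexagon v}))^[n] ⟨p, hp⟩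
  have horbit : ∀ n, orbit (n + 1) = ⟨_, hstep (orbit n)⟩ := fun n =>
    Function.iterate_succ_apply' _ _ _
  have hmixed : ∀ i, IsDigitSeq (nibbleSeq fun n => N (orbit n) i) ∧
      HasMixedBlocks (nibbleSeq fun n => N (orbit n) i) := fun i =>
    ⟨isDigitSeq_nibbleSeq _, hasMixedBlocks_nibbleSeq fun n => hN (orbit n) i⟩
  refine ⟨_, _, _, hmixed 0, hmixed 1, hmixed 2, ?_, ?_⟩
  · exact piQ_sub_piQ_of_orbit (by linarith) (x := fun n => (orbit n).1.1)
      (fun n => (orbit n).2.1) (fun n => by rw [horbit n])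
  · exact piQ_sub_piQ_of_orbit (by linarith) (x := fun n => (orbit n).1.2)
      (fun n => (orbit n).2.2.1) (fun n => by rw [horbit n])

/-! ### A point with exactly three expansions -/

lemma encard_sigmaSet_eq_three {q : ℝ} (hq : 1 < q) (hδ : 1 / (q - 1) - 1 < 1 / q ^ 7) (k : ℕ)
    {a b c : ℕ → ℝ} (ha : IsDigitSeq a) (hb : IsDigitSeq b) (hc : IsDigitSeq c)
    (ha' : HasMixedBlocks a) (hb' : HasMixedBlocks b) (hc' : HasMixedBlocks c)
    (hab : piQ q ((consSeq 1)^[k + 2] b) = 1 + piQ q ((consSeq 0)^[k + 2] a))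
    (hac : piQ q ((consSeq 1)^[2 * (k + 2)] c)
      = 1 + piQ q ((consSeq 0)^[k + 1] (consSeq 1 ((consSeq 0)^[k + 2] a)))) :
    (SigmaSet q (piQ q ((consSeq 0) ((consSeq 1)^[2 * (k + 2)] c)))).encard = 3 := by
  have hq0 : q ≠ 0 := by linarith
  set A := (consSeq 0)^[k + 2] a with hA
  set B := (consSeq 1)^[k + 2] b with hB
  set C := (consSeq 1)^[2 * (k + 2)] c with hC
  have dA : IsDigitSeq A := ha.iterate_consSeq (Or.inl rfl) _
  have dB : IsDigitSeq B := hb.iterate_consSeq (Or.inr rfl) _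
  have dC : IsDigitSeq C := hc.iterate_consSeq (Or.inr rfl) _
  have rA : RepeatsSoon A := (ha'.repeatsSoon_iterate_consSeq ha (Or.inl rfl) _).1
  have rB : RepeatsSoon B := (hb'.repeatsSoon_iterate_consSeq hb (Or.inr rfl) _).1
  have rC : RepeatsSoon C := (hc'.repeatsSoon_iterate_consSeq hc (Or.inr rfl) _).1
  have dA1 := dA.consSeq (p := 1) (Or.inr rfl)
  have dB0 := dB.consSeq (p := 0) (Or.inl rfl)
  have dA2 := dA1.iterate_consSeq (p := 0) (Or.inl rfl) (k + 1)
  have dB2 := dB0.iterate_consSeq (p := 0) (Or.inl rfl) (k + 1)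
  have eAB : piQ q (consSeq 0 B) = piQ q (consSeq 1 A) := by
    rw [piQ_consSeq hq _ dA, piQ_consSeq hq _ dB, hab, zero_add]
  have eAB2 : piQ q ((consSeq 0)^[k + 1] (consSeq 0 B))
      = piQ q ((consSeq 0)^[k + 1] (consSeq 1 A)) := by
    have h1 := piQ_iterate_consSeq hq (p := 0) (Or.inl rfl) dA1 (k + 1)
    have h2 := piQ_iterate_consSeq hq (p := 0) (Or.inl rfl) dB0 (k + 1)
    rw [eAB, ← h1] at h2
    exact mul_left_cancel₀ (pow_ne_zero _ hq0) h2
  have eC : piQ q (consSeq 0 C) = piQ q (consSeq 1 ((consSeq 0)^[k + 1] (consSeq 1 A))) := by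
    rw [piQ_consSeq hq _ dA2, piQ_consSeq hq _ dC, hac, zero_add]
  have hz1 : piQ q (consSeq 1 A) < 1 := by
    have h0 : consSeq 1 A 1 = 0 := by
      rw [hA, Function.iterate_succ_apply']
      rfl
    have h1 := piQ_le_sub_one_div_pow hq dA1 h0
    have h2 := one_div_pow_le_one_div_pow_succ hq (show 1 < 7 by norm_num)
    linarith
  have hset : SigmaSet q (piQ q (consSeq 0 C)) =
      {consSeq 0 C, consSeq 1 ((consSeq 0)^[k + 1] (consSeq 1 A)),
        consSeq 1 ((consSeq 0)^[k + 1] (consSeq 0 B))} := by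
    ext s
    simp only [Set.mem_insert_iff, Set.mem_singleton_iff]
    constructor
    · rintro ⟨hs, hsx⟩
      rcases hs 0 with h0 | h0
      · left
        have := piQ_tailSeq_eq hq (dC.consSeq (p := 0) (Or.inl rfl)) hs hsx h0
        rw [← consSeq_tailSeq s, h0, rC.eq_of_piQ_eq hq hδ dC hs.tailSeq this]
      · right
        have ht := piQ_tailSeq_eq hq (dA2.consSeq (p := 1) (Or.inr rfl)) hs (hsx.trans eC) h0
        rw [tailSeq_consSeq] at ht
        obtain ⟨s', hs', hv, hst⟩ := exists_eq_iterate_consSeq_zero hq dA1 hz1 _ hs.tailSeq ht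
        rw [← consSeq_tailSeq s, h0, hst]
        rcases hs' 0 with h0' | h0'
        · right
          have := piQ_tailSeq_eq hq dB0 hs' (hv.trans eAB.symm) h0'
          rw [← consSeq_tailSeq s', h0', rB.eq_of_piQ_eq hq hδ dB hs'.tailSeq this]
        · left
          have := piQ_tailSeq_eq hq dA1 hs' hv h0'
          rw [← consSeq_tailSeq s', h0', rA.eq_of_piQ_eq hq hδ dA hs'.tailSeq this]
    · rintro (rfl | rfl | rfl)
      · exact ⟨dC.consSeq (Or.inl rfl), rfl⟩
      · exact ⟨dA2.consSeq (Or.inr rfl), eC.symm⟩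
      · refine ⟨dB2.consSeq (Or.inr rfl), ?_⟩
        rw [eC, piQ_consSeq hq _ dB2, piQ_consSeq hq _ dA2, eAB2]
  have hne : ∀ s : ℕ → ℝ, consSeq 0 C ≠ consSeq 1 s := by
    intro s h
    have := congrFun h 0
    simp [consSeq] at this
  have hinj : ∀ n, ∀ s t : ℕ → ℝ, (consSeq 0)^[n] s = (consSeq 0)^[n] t → s = t := by
    intro n
    induction n with
    | zero => exact fun s t h => h
    | succ n ih =>
      intro s t h
      rw [Function.iterate_succ_apply', Function.iterate_succ_apply'] at h
      exact ih s t (congrArg tailSeq h)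
  have hne' : consSeq 1 ((consSeq 0)^[k + 1] (consSeq 1 A))
      ≠ consSeq 1 ((consSeq 0)^[k + 1] (consSeq 0 B)) := by
    intro h
    have := congrFun (hinj _ _ _ (congrArg tailSeq h)) 0
    simp [consSeq] at this
  rw [hset]
  exact Set.encard_eq_three.2 ⟨_, _, _, hne _, hne _, hne', rfl⟩

/-! ### Bases close to the `k`-Bonacci number -/

lemma IsBonacci.pow_mul_two_sub {k : ℕ} {x : ℝ} (hx : IsBonacci k x) : x ^ k * (2 - x) = 1 := by
  have h := geom_sum_mul x k
  rw [← hx.2] at h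
  linarith

lemma IsBonacci.le_of_ten_le {k : ℕ} (hk : 10 ≤ k) {x : ℝ} (hx : IsBonacci k x) : 1.999 ≤ x := by
  by_contra! hlt
  obtain ⟨⟨h1, -⟩, h⟩ := hx
  have hx0 : 0 < x := by linarith
  have h2 : (∑ i ∈ Finset.range k, (x⁻¹) ^ (i + 1)) = 1 := by
    rw [← Finset.sum_range_reflect]
    have : ∀ j ∈ Finset.range k, (x⁻¹) ^ (k - 1 - j + 1) = x ^ j / x ^ k := by
      intro j hj
      have hj' := Finset.mem_range.1 hj
      rw [show k - 1 - j + 1 = k - j by omega, inv_pow, eq_div_iff (by positivity),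
        inv_mul_eq_iff_eq_mul₀ (by positivity), ← pow_add]
      congr 1
      omega
    rw [Finset.sum_congr rfl this, ← Finset.sum_div, ← h, div_self (by positivity)]
  have h3 : ∑ i ∈ Finset.range 10, (x⁻¹) ^ (i + 1) ≤ ∑ i ∈ Finset.range k, (x⁻¹) ^ (i + 1) :=
    Finset.sum_le_sum_of_subset_of_nonneg (Finset.range_mono hk)
      (fun i _ _ => by positivity)
  have h4 : ∑ i ∈ Finset.range 10, ((1.999 : ℝ)⁻¹) ^ (i + 1)
      ≤ ∑ i ∈ Finset.range 10, (x⁻¹) ^ (i + 1) :=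
    Finset.sum_le_sum fun i _ =>
      pow_le_pow_left₀ (by norm_num) (inv_anti₀ hx0 hlt.le) _
  have h5 : (1 : ℝ) < ∑ i ∈ Finset.range 10, ((1.999 : ℝ)⁻¹) ^ (i + 1) := by
    norm_num [Finset.sum_range_succ]
  linarith

lemma IsBonacci.two_pow_le {k : ℕ} (hk : 10 ≤ k) {x : ℝ} (hx : IsBonacci k x) :
    (k : ℝ) ≤ x ^ k ∧ 2 ^ k ≤ 2 * x ^ k := by
  have h1 := hx.le_of_ten_le hk
  have h2 := hx.pow_mul_two_sub
  have hx0 : 0 < x := by linarith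
  have hkx : (k : ℝ) ≤ x ^ k := by
    have := one_add_mul_le_pow (a := x - 1) (by linarith) k
    rw [add_sub_cancel] at this
    have hk' : (10 : ℝ) ≤ k := by exact_mod_cast hk
    nlinarith
  refine ⟨hkx, ?_⟩
  have h3 := one_add_mul_le_pow (a := (x / 2 - 1)) (by linarith) k
  rw [add_sub_cancel, div_pow, le_div_iff₀ (by positivity)] at h3
  have h4 : (k : ℝ) * (2 - x) ≤ 1 := by
    rw [← h2]
    exact mul_le_mul_of_nonneg_right hkx (by linarith [hx.1.2])
  have h5 : (1 / 2 : ℝ) ≤ 1 + k * (x / 2 - 1) := by linarith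
  have h6 := mul_le_mul_of_nonneg_right h5 (show (0 : ℝ) ≤ 2 ^ k by positivity)
  linarith

lemma IsBonacci.near {k : ℕ} (hk : 10 ≤ k) {x q : ℝ} (hx : IsBonacci k x)
    (hq : q ∈ Set.Ioo (1 : ℝ) 2) (h : |q - x| ≤ x ^ (-(2 * (k : ℤ)) - 6)) :
    1.9989 ≤ q ∧ (q ^ k + 1) * |1 - q ^ k * (2 - q)| ≤ 0.6 := by
  have h1 := hx.le_of_ten_le hk
  have h2 := hx.pow_mul_two_sub
  obtain ⟨hkM, h2M⟩ := hx.two_pow_le hk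
  have hx0 : 0 < x := by linarith
  have hx2 := hx.1.2
  set M := x ^ k with hM
  have hM1000 : 500 ≤ M := by
    have : (2 : ℝ) ^ 10 ≤ 2 ^ k := pow_le_pow_right₀ (by norm_num) hk
    norm_num at this
    linarith
  have h60 : 60 ≤ x ^ 6 := by
    have := pow_le_pow_left₀ (by norm_num) h1 6
    norm_num at this
    linarith
  have hd : |q - x| * (60 * M ^ 2) ≤ 1 := by
    have e : x ^ (-(2 * (k : ℤ)) - 6) = (M ^ 2 * x ^ 6)⁻¹ := by
      rw [hM, ← pow_mul, ← pow_add, ← zpow_natCast, ← zpow_neg]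
      congr 1
      push_cast
      ring
    rw [e, ← one_div, le_div_iff₀ (by positivity)] at h
    refine le_trans ?_ h
    rw [mul_comm 60]
    gcongr
  have hd0 := abs_nonneg (q - x)
  have hdM : |q - x| * M ≤ 0.0001 := by
    nlinarith [mul_nonneg hd0 (show (0 : ℝ) ≤ M by linarith)]
  have hdx : |q - x| ≤ 0.0001 := by nlinarith
  have hqk : q ^ k ≤ 2 * M :=
    (pow_le_pow_left₀ (by linarith [hq.1]) hq.2.le k).trans h2M
  have hq0 : 0 ≤ q ^ k := pow_nonneg (by linarith [hq.1]) k
  refine ⟨by linarith [(abs_le.1 hdx).1], ?_⟩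
  have key : |1 - q ^ k * (2 - q)| ≤ 4 * M * |q - x| := by
    have e : 1 - q ^ k * (2 - q) = (2 - x) * (M - q ^ k) + q ^ k * (q - x) := by
      rw [← h2]
      ring
    have h3 : |M - q ^ k| ≤ k * 2 ^ k * |q - x| := by
      have hmax : max |x| |q| ≤ 2 := by
        rw [abs_of_pos hx0, abs_of_pos (by linarith [hq.1])]
        exact max_le hx2.le hq.2.le
      have hpow : max |x| |q| ^ (k - 1) ≤ 2 ^ k :=
        (pow_le_pow_left₀ (by positivity) hmax _).trans
          (pow_le_pow_right₀ (by norm_num) (Nat.sub_le k 1))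
      calc |M - q ^ k| ≤ |x - q| * k * max |x| |q| ^ (k - 1) := abs_pow_sub_pow_le _ _ _
        _ ≤ |x - q| * k * 2 ^ k := by gcongr
        _ = k * 2 ^ k * |q - x| := by rw [abs_sub_comm x q]; ring
    have h4 : (k : ℝ) * 2 ^ k ≤ M * (2 * M) := by gcongr
    calc |1 - q ^ k * (2 - q)|
        ≤ (2 - x) * |M - q ^ k| + q ^ k * |q - x| := by
          rw [e]
          refine (abs_add_le _ _).trans ?_
          rw [abs_mul, abs_mul, abs_of_nonneg hq0, abs_of_pos (by linarith : 0 < 2 - x)]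
      _ ≤ (2 - x) * (M * (2 * M) * |q - x|) + 2 * M * |q - x| := by
          have : (0 : ℝ) ≤ 2 - x := by linarith
          gcongr
          exact h3.trans (mul_le_mul_of_nonneg_right h4 hd0)
      _ = (M * (2 - x)) * (2 * M * |q - x|) + 2 * M * |q - x| := by ring
      _ = 4 * M * |q - x| := by rw [h2]; ring
  calc (q ^ k + 1) * |1 - q ^ k * (2 - q)| ≤ (3 * M) * (4 * M * |q - x|) := by
        gcongr
        linarith
    _ = 12 / 60 * (|q - x| * (60 * M ^ 2)) := by ring
    _ ≤ 0.6 := by linarith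

lemma inHexagon_of_mul_le {Q r e : ℝ} (hQ : 0 ≤ Q) (hr : 0.99 ≤ r) (h : (Q + 1) * |e| ≤ 0.6) :
    InHexagon (e / r, (Q + 1) * e / r) := by
  have hr0 : 0 < r := by linarith
  have he := abs_nonneg e
  have hQe := mul_nonneg hQ he
  refine ⟨?_, ?_, ?_⟩
  · rw [abs_div, abs_of_pos hr0, div_le_iff₀ hr0]
    linarith
  · rw [abs_div, abs_of_pos hr0, div_le_iff₀ hr0, abs_mul, abs_of_nonneg (by linarith : 0 ≤ Q + 1)]
    linarith
  · rw [← sub_div, abs_div, abs_of_pos hr0, div_le_iff₀ hr0,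
      show e - (Q + 1) * e = -(Q * e) by ring, abs_neg, abs_mul, abs_of_nonneg hQ]
    linarith

theorem B3_contains_neighbourhood_of_qk
    (k : ℕ) (hk : 10 ≤ k) (qk : ℝ) (hqk : IsBonacci k qk)
    (q : ℝ) (hq : q ∈ Set.Ioo (1 : ℝ) 2)
    (hclose : |q - qk| ≤ qk ^ (-(2 * (k : ℤ)) - 6)) :
    q ∈ Bset 3 := by
  obtain ⟨hq1, hq2⟩ := hq
  obtain ⟨hlow, hsmall⟩ := hqk.near hk ⟨hq1, hq2⟩ hclose
  have hr : q - 1 ≠ 0 := by linarith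
  have hq0 : q ≠ 0 := by linarith
  have hδ : 1 / (q - 1) - 1 < 1 / q ^ 7 := by
    have h7 : q ^ 7 ≤ 128 := (pow_le_pow_left₀ (by linarith) hq2.le 7).trans (by norm_num)
    have h1 : (1 : ℝ) / 128 ≤ 1 / q ^ 7 := one_div_le_one_div_of_le (by positivity) h7
    have h2 : 1 / (q - 1) < 1 + 1 / 128 := by
      rw [div_lt_iff₀ (by linarith)]
      linarith
    linarith
  obtain ⟨a, b, c, ⟨da, ma⟩, ⟨db, mb⟩, ⟨dc, mc⟩, hb, hc⟩ := exists_three_mixed hlow hq2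
    (inHexagon_of_mul_le (pow_nonneg (by linarith) k) (by linarith : 0.99 ≤ q - 1) hsmall)
  obtain ⟨k, rfl⟩ := Nat.exists_eq_add_of_le' (show 2 ≤ k by omega)
  have hA := piQ_iterate_consSeq hq1 (p := 0) (Or.inl rfl) da (k + 2)
  have hB := piQ_iterate_consSeq hq1 (p := 1) (Or.inr rfl) db (k + 2)
  have hC := piQ_iterate_consSeq hq1 (p := 1) (Or.inr rfl) dc (2 * (k + 2))
  have dA := da.iterate_consSeq (p := 0) (Or.inl rfl) (k + 2)
  have dC := dc.iterate_consSeq (p := 1) (Or.inr rfl) (2 * (k + 2))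
  have hZ := piQ_iterate_consSeq hq1 (p := 0) (Or.inl rfl) (dA.consSeq (p := 1) (Or.inr rfl)) (k + 1)
  rw [piQ_consSeq hq1 1 dA, eq_comm] at hZ
  have hQ0 : q ^ (k + 2) ≠ 0 := pow_ne_zero _ hq0
  have hab : piQ q ((consSeq 1)^[k + 2] b) = 1 + piQ q ((consSeq 0)^[k + 2] a) := by
    apply mul_left_cancel₀ hQ0
    rw [mul_add, hA, hB, hb]
    field_simp
    ring
  have hac : piQ q ((consSeq 1)^[2 * (k + 2)] c)
      = 1 + piQ q ((consSeq 0)^[k + 1] (consSeq 1 ((consSeq 0)^[k + 2] a))) := by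
    apply mul_left_cancel₀ (pow_ne_zero (2 * (k + 2)) hq0)
    have hZ' : q ^ (k + 2) * piQ q ((consSeq 0)^[k + 1] (consSeq 1 ((consSeq 0)^[k + 2] a)))
        = 1 + piQ q ((consSeq 0)^[k + 2] a) := by
      rw [pow_succ q (k + 1), mul_right_comm, ← hZ]
      field_simp
      ring
    have e : q ^ (2 * (k + 2)) = q ^ (k + 2) * q ^ (k + 2) := by ring
    rw [hC, e, mul_add, mul_assoc _ _ (piQ q _), hZ', mul_add, hA, hc]
    field_simp
    ring
  have dx := dC.consSeq (p := 0) (Or.inl rfl)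
  exact ⟨⟨hq1, hq2⟩, _, ⟨piQ_nonneg hq1 dx, piQ_le hq1 dx⟩,
    encard_sigmaSet_eq_three hq1 hδ k da db dc ma mb mc hab hac⟩
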